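/- The set of nested words encoding grids is EMSO-definable relative to all nested words: over the 2-stack alphabet with Σ_c^1={a}, Σ_r^1={ā}, Σ_c^2={b}, Σ_r^2={b̄}, the image Φ(𝔾) = {Φ(G(n,m)) | n,m ≥ 1} of the set of all grids under the grid encoding equals the set of nested words W that (i) have underlying string in the regular language a⁺[(āb)⁺(b̄a)⁺]*ā⁺ + a⁺[(āb)⁺(b̄a)⁺]*(āb)⁺b̄⁺, (ii) satisfy ∀x∃y (μ(x,y) ∨ μ(y,x)) (every position is matched), and (iii) satisfy the first-order consistency property that consecutive calls of the same letter have returns at distance 1 or 2 in the corresponding pattern (as spelled out in the paper). In particular, Φ(𝔾) is Σ₁(τ_Σ̃)-definable relative to NW(Σ̃). -/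

import Mathlib

/-- The *kind* of a letter in a `K`-stack call-return alphabet: a call of some
stack `s`, a return of some stack `s`, or an internal action. -/
inductive CRKind (K : ℕ) where
  | call (s : Fin K)
  | ret (s : Fin K)
  | int

/-- A `K`-stack call-return alphabet over the letters `A`: every letter is
(exclusively) a call of one stack, a return of one stack, or internal.  This
encodes the pairwise disjointness of the collection
`⟨{(Σ_c^s, Σ_r^s)}_{s∈[K]}, Σ_int⟩` together with `Σ` being their union. -/
structure CRAlphabet (K : ℕ) (A : Type) where
  kind : A → CRKind K

namespace CRAlphabet

variable {K : ℕ} {A : Type}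

def callSet (h : CRAlphabet K A) (s : Fin K) : Set A := {a | h.kind a = .call s}
def retSet (h : CRAlphabet K A) (s : Fin K) : Set A := {a | h.kind a = .ret s}
def intSet (h : CRAlphabet K A) : Set A := {a | h.kind a = .int}

end CRAlphabet

/-- `s`-well-formed strings: generated by the grammar
`A ::= aAb | AA | ε | c` with `a ∈ c`, `b ∈ r`, `c ∉ c ∪ r`. -/
inductive SWellFormed {A : Type} (c r : Set A) : List A → Prop where
  | nil : SWellFormed c r []
  | single {x : A} : x ∉ c → x ∉ r → SWellFormed c r [x]
  | wrap {a b : A} {u : List A} : a ∈ c → b ∈ r → SWellFormed c r u →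
      SWellFormed c r (a :: u ++ [b])
  | concat {u v : List A} : SWellFormed c r u → SWellFormed c r v →
      SWellFormed c r (u ++ v)

/-- The matching relation `μ^s` of the nested word determined by the string
`w` (positions `0`-based): `(i,j) ∈ μ^s` iff `i < j`, `λ(i) ∈ Σ_c^s`,
`λ(j) ∈ Σ_r^s` and `λ(i+1) … λ(j-1)` is `s`-well formed. -/
def Matched {K : ℕ} {A : Type} (h : CRAlphabet K A) (w : List A) (s : Fin K)
    (i j : ℕ) : Prop :=
  i < j ∧ j < w.length ∧
  (∃ a, w[i]? = some a ∧ a ∈ h.callSet s) ∧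
  (∃ b, w[j]? = some b ∧ b ∈ h.retSet s) ∧
  SWellFormed (h.callSet s) (h.retSet s) ((w.take j).drop (i + 1))

/-- The full matching relation `μ = ⋃_s μ^s`. -/
def MuAny {K : ℕ} {A : Type} (h : CRAlphabet K A) (w : List A) (i j : ℕ) : Prop :=
  ∃ s, Matched h w s i j

/-- The letters of the 2-stack call-return alphabet with `Σ_c^1 = {a}`,
`Σ_r^1 = {ā}`, `Σ_c^2 = {b}`, `Σ_r^2 = {b̄}`, `Σ_int = ∅`. -/
inductive L2 where
  | a | abar | b | bbar
deriving DecidableEq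

def h2 : CRAlphabet 2 L2 :=
  ⟨fun x => match x with
    | .a => .call 0 | .abar => .ret 0
    | .b => .call 1 | .bbar => .ret 1⟩

/-- MSO formulas over the signature `τ_Σ̃ = {λ_a | a ∈ Σ} ∪ {⋖, μ}` of nested
words (first-order variables and second-order variables are indexed by `ℕ`). -/
inductive MSO (A : Type) where
  | lab (a : A) (x : ℕ)
  | succ (x y : ℕ)
  | mu (x y : ℕ)
  | eq (x y : ℕ)
  | mem (x : ℕ) (X : ℕ)
  | not (φ : MSO A)
  | or (φ ψ : MSO A)
  | ex1 (x : ℕ) (φ : MSO A)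
  | ex2 (X : ℕ) (φ : MSO A)

/-- Satisfaction of an MSO formula in the nested word of `w`, under
first-order valuation `ν` and second-order valuation `μv`. -/
def Sat {K : ℕ} {A : Type} (h : CRAlphabet K A) (w : List A) :
    MSO A → (ℕ → ℕ) → (ℕ → Set ℕ) → Prop
  | .lab a x, ν, _ => w[(ν x)]? = some a
  | .succ x y, ν, _ => ν y = ν x + 1 ∧ ν y < w.length
  | .mu x y, ν, _ => MuAny h w (ν x) (ν y)
  | .eq x y, ν, _ => ν x = ν y
  | .mem x X, ν, μv => ν x ∈ μv X
  | .not φ, ν, μv => ¬ Sat h w φ ν μv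
  | .or φ ψ, ν, μv => Sat h w φ ν μv ∨ Sat h w ψ ν μv
  | .ex1 x φ, ν, μv => ∃ i < w.length, Sat h w φ (Function.update ν x i) μv
  | .ex2 X φ, ν, μv => ∃ S : Set ℕ, S ⊆ {i | i < w.length} ∧
      Sat h w φ ν (Function.update μv X S)

/-- First-order formulas: no second-order quantification. -/
def FirstOrder {A : Type} : MSO A → Prop
  | .not φ => FirstOrder φ
  | .or φ ψ => FirstOrder φ ∧ FirstOrder ψ
  | .ex1 _ φ => FirstOrder φ
  | .ex2 _ _ => False
  | _ => True

/-- Existential MSO formulas: a block of existential second-order quantifiers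
followed by a first-order formula. -/
inductive IsEMSO {A : Type} : MSO A → Prop where
  | fo {φ} : FirstOrder φ → IsEMSO φ
  | ex {X φ} : IsEMSO φ → IsEMSO (MSO.ex2 X φ)

/-- Semantic sentencehood: satisfaction does not depend on the valuations. -/
def ClosedOn {K : ℕ} {A : Type} (h : CRAlphabet K A) (φ : MSO A) : Prop :=
  ∀ w ν ν' μv μv', Sat h w φ ν μv ↔ Sat h w φ ν' μv'

/-- The set of nested words (nonempty strings) defined by a sentence. -/
def mLang {K : ℕ} {A : Type} (h : CRAlphabet K A) (φ : MSO A) : Set (List A) :=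
  {w | w ≠ [] ∧ Sat h w φ (fun _ => 0) (fun _ => ∅)}

/-- `k`-fold repetition of a word. -/
def pw (u : List L2) (k : ℕ) : List L2 := (List.replicate k u).flatten

/-- The encoding of the `(n,m)`-grid as a nested word:
`aⁿ[(āb)ⁿ(b̄a)ⁿ]^{(m−1)/2} āⁿ` for odd `m`, and
`aⁿ[(āb)ⁿ(b̄a)ⁿ]^{m/2−1}(āb)ⁿ b̄ⁿ` for even `m`. -/
def encodeGrid (n m : ℕ) : List L2 :=
  if m % 2 = 1 then
    pw [L2.a] n ++ pw (pw [L2.abar, L2.b] n ++ pw [L2.bbar, L2.a] n) ((m - 1) / 2)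
      ++ pw [L2.abar] n
  else
    pw [L2.a] n ++ pw (pw [L2.abar, L2.b] n ++ pw [L2.bbar, L2.a] n) (m / 2 - 1)
      ++ pw [L2.abar, L2.b] n ++ pw [L2.bbar] n

/-- First-order formulas over the grid signature
`τ_Grids = {P_a, P_b, succ₁, succ₂}` (variables indexed by `ℕ`). -/
inductive GF where
  | pa (x : ℕ)
  | pb (x : ℕ)
  | s1 (x y : ℕ)
  | s2 (x y : ℕ)
  | eq (x y : ℕ)
  | not (φ : GF)
  | or (φ ψ : GF)
  | ex (x : ℕ) (φ : GF)

/-- Satisfaction in the `(n,m)`-grid `G(n,m)` (nodes are pairs `(i,j)` with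
`i < n`, `j < m`, `0`-based; column `j` is labeled `a` iff `j` is even,
i.e. the `1`-based column index `j+1` is odd). -/
def GSat (n m : ℕ) : GF → (ℕ → ℕ × ℕ) → Prop
  | .pa x, ν => (ν x).2 % 2 = 0
  | .pb x, ν => (ν x).2 % 2 = 1
  | .s1 x y, ν => (ν y).1 = (ν x).1 + 1 ∧ (ν y).2 = (ν x).2 ∧ (ν y).1 < n
  | .s2 x y, ν => (ν y).2 = (ν x).2 + 1 ∧ (ν y).1 = (ν x).1 ∧ (ν y).2 < m
  | .eq x y, ν => ν x = ν y
  | .not φ, ν => ¬ GSat n m φ ν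
  | .or φ ψ, ν => GSat n m φ ν ∨ GSat n m ψ ν
  | .ex x φ, ν => ∃ p : ℕ × ℕ, p.1 < n ∧ p.2 < m ∧
      GSat n m φ (Function.update ν x p)

/-- A block `(āb)^k (b̄a)^l` with `k,l ≥ 1`. -/
def ABBlock (u : List L2) : Prop :=
  ∃ k l, 1 ≤ k ∧ 1 ≤ l ∧ u = pw [L2.abar, L2.b] k ++ pw [L2.bbar, L2.a] l

/-- (i) the underlying string lies in the regular language
`a⁺[(āb)⁺(b̄a)⁺]*ā⁺ + a⁺[(āb)⁺(b̄a)⁺]*(āb)⁺b̄⁺`. -/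
def RegexCond (w : List L2) : Prop :=
  (∃ p, 1 ≤ p ∧ ∃ bs : List (List L2), (∀ u ∈ bs, ABBlock u) ∧
    ∃ q, 1 ≤ q ∧ w = pw [L2.a] p ++ bs.flatten ++ pw [L2.abar] q) ∨
  (∃ p, 1 ≤ p ∧ ∃ bs : List (List L2), (∀ u ∈ bs, ABBlock u) ∧
    ∃ k, 1 ≤ k ∧ ∃ q, 1 ≤ q ∧
      w = pw [L2.a] p ++ bs.flatten ++ pw [L2.abar, L2.b] k ++ pw [L2.bbar] q)

/-- (ii) every position is matched: `∀x∃y (μ(x,y) ∨ μ(y,x))`. -/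
def AllMatched (w : List L2) : Prop :=
  ∀ i < w.length, ∃ j, MuAny h2 w i j ∨ MuAny h2 w j i

/-- (iii) the first-order consistency property of the paper on matched pairs
`(x₁,y₁)`, `(x₂,y₂)` with equally labeled calls. -/
def Consistent (w : List L2) : Prop :=
  ∀ x₁ y₁ x₂ y₂, MuAny h2 w x₁ y₁ → MuAny h2 w x₂ y₂ →
    w[x₁]? = w[x₂]? →
    ((w[x₁]? = some L2.a → x₂ = x₁ + 1 → (y₁ = y₂ + 1 ∨ y₁ = y₂ + 2)) ∧
     (w[y₁]? = some L2.abar → y₁ = y₂ + 1 → (x₂ = x₁ + 1 ∨ x₂ = x₁ + 2)) ∧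
     (w[y₁]? = some L2.bbar → y₁ = y₂ + 1 → x₂ = x₁ + 2) ∧
     (x₂ = x₁ + 2 → w[x₁ + 1]? ≠ w[x₁]? → (y₁ = y₂ + 1 ∨ y₁ = y₂ + 2)) ∧
     (y₁ = y₂ + 2 → w[y₂ + 1]? ≠ w[y₂]? → (x₂ = x₁ + 1 ∨ x₂ = x₁ + 2)))

namespace GridEncoding

section Matching

variable {K : ℕ} {A : Type}

open Classical in
/-- Number of letters of `c` minus number of letters of `r`. -/
noncomputable def balance (c r : Set A) (u : List A) : ℤ :=
  (u.map fun x => if x ∈ c then (1 : ℤ) else if x ∈ r then -1 else 0).sum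

lemma balance_append (c r : Set A) (u v : List A) :
    balance c r (u ++ v) = balance c r u + balance c r v := by
  simp [balance]

lemma balance_call {c r : Set A} {x : A} (hx : x ∈ c) : balance c r [x] = 1 := by
  simp [balance, hx]

lemma balance_ret {c r : Set A} (hcr : ∀ x ∈ r, x ∉ c) {x : A} (hx : x ∈ r) :
    balance c r [x] = -1 := by
  simp [balance, hx, hcr x hx]

lemma balance_eq_zero_of_sWellFormed {c r : Set A} (hcr : ∀ x ∈ r, x ∉ c) {u : List A}
    (hu : SWellFormed c r u) : balance c r u = 0 := by
  induction hu with
  | nil => simp [balance]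
  | single h1 h2 => simp [balance, h1, h2]
  | @wrap a b u ha hb _ ih =>
    rw [← List.singleton_append, balance_append, balance_append, ih, balance_call ha,
      balance_ret hcr hb]
    norm_num
  | concat _ _ ih1 ih2 => rw [balance_append, ih1, ih2]; norm_num

lemma balance_take_nonneg_of_sWellFormed {c r : Set A} (hcr : ∀ x ∈ r, x ∉ c) {u : List A}
    (hu : SWellFormed c r u) : ∀ k, 0 ≤ balance c r (u.take k) := by
  induction hu with
  | nil => simp [balance]
  | @single x h1 h2 =>
    rintro (_ | k) <;> simp [balance, h1, h2]
  | @wrap a b u ha hb hu ih =>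
    rintro (_ | k)
    · simp [balance]
    · rw [List.cons_append, List.take_succ_cons, ← List.singleton_append, balance_append,
        List.take_append, balance_append, balance_call ha]
      have h1 := ih k
      rcases Nat.eq_zero_or_pos (k - u.length) with h | h
      · simp only [h, List.take_zero]
        have : balance c r ([] : List A) = 0 := by simp [balance]
        omega
      · rw [List.take_of_length_le (l := [b]) (by simp; omega), balance_ret hcr hb]
        omega
  | @concat u v hu _ ih1 ih2 =>
    intro k
    rw [List.take_append, balance_append]
    have := ih1 k
    have := ih2 (k - u.length)
    omega

lemma callSet_retSet_disjoint (h : CRAlphabet K A) (s : Fin K) :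
    ∀ x ∈ h.retSet s, x ∉ h.callSet s := by
  intro x hx hx'
  simp only [CRAlphabet.retSet, CRAlphabet.callSet, Set.mem_ofPred_eq] at hx hx'
  rw [hx] at hx'
  cases hx'

lemma matched_not_lt {h : CRAlphabet K A} {w : List A} {s : Fin K} {x y y' : ℕ}
    (h1 : Matched h w s x y) (h2 : Matched h w s x y') : ¬ y < y' := by
  intro hlt
  obtain ⟨hxy, hyw, -, ⟨b, hb, hbr⟩, hwf⟩ := h1
  obtain ⟨hxy', hyw', -, -, hwf'⟩ := h2
  have hd := callSet_retSet_disjoint h s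
  have hz := balance_eq_zero_of_sWellFormed hd hwf
  have hn := balance_take_nonneg_of_sWellFormed hd hwf' (y - x)
  have key : ((w.take y').drop (x + 1)).take (y - x) = (w.take y).drop (x + 1) ++ [b] := by
    rw [List.take_drop, List.take_take, show min (x + 1 + (y - x)) y' = y + 1 by omega,
      List.take_add_one, hb, Option.toList_some, List.drop_append_of_le_length]
    simp; omega
  rw [key, balance_append, hz, balance_ret hd hbr] at hn
  omega

lemma muAny_unique {h : CRAlphabet K A} {w : List A} {x y y' : ℕ}
    (h1 : MuAny h w x y) (h2 : MuAny h w x y') : y = y' := by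
  obtain ⟨s, h1⟩ := h1
  obtain ⟨s', h2⟩ := h2
  have hs : s = s' := by
    obtain ⟨-, -, ⟨a, ha, hac⟩, -⟩ := h1
    obtain ⟨-, -, ⟨a', ha', hac'⟩, -⟩ := h2
    rw [ha] at ha'
    cases ha'
    simp only [CRAlphabet.callSet, Set.mem_ofPred_eq] at hac hac'
    rw [hac] at hac'
    cases hac'
    rfl
  subst hs
  have := matched_not_lt h1 h2
  have := matched_not_lt h2 h1
  omega

end Matching

lemma pw_zero (u : List L2) : pw u 0 = [] := rfl

lemma pw_succ (u : List L2) (k : ℕ) : pw u (k + 1) = u ++ pw u k := by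
  simp [pw, List.replicate_succ]

lemma pw_add (u : List L2) (k l : ℕ) : pw u (k + l) = pw u k ++ pw u l := by
  simp only [pw, List.replicate_add, List.flatten_append]

lemma pw_succ' (u : List L2) (k : ℕ) : pw u (k + 1) = pw u k ++ u := by
  rw [pw_add]; simp [pw]

lemma length_pw (u : List L2) (k : ℕ) : (pw u k).length = k * u.length := by
  simp [pw]

lemma getElem?_pw (u : List L2) {k i e : ℕ} (hi : i < k) (he : e < u.length) :
    (pw u k)[i * u.length + e]? = u[e]? := by
  obtain ⟨l, rfl⟩ : ∃ l, k = i + (l + 1) := ⟨k - i - 1, by omega⟩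
  rw [pw_add, List.getElem?_append_right (by rw [length_pw]; omega), length_pw, pw_succ,
    List.getElem?_append_left (by omega)]
  congr 1
  omega

lemma sWellFormed_of_neutral {A : Type} {c r : Set A} {u : List A}
    (h : ∀ x ∈ u, x ∉ c ∧ x ∉ r) : SWellFormed c r u := by
  induction u with
  | nil => exact .nil
  | cons x u ih =>
    have := h x (by simp)
    exact .concat (u := [x]) (.single this.1 this.2) (ih fun y hy => h y (by simp [hy]))

lemma sWellFormed_pw_pw {c r : Set L2} {x y : L2} {u v : List L2} (hx : x ∈ c) (hy : y ∈ r)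
    (hu : ∀ z ∈ u, z ∉ c ∧ z ∉ r) (hv : ∀ z ∈ v, z ∉ c ∧ z ∉ r) (k : ℕ) :
    SWellFormed c r (pw (u ++ [x]) k ++ pw (y :: v) k) := by
  induction k with
  | zero => exact .nil
  | succ k ih =>
    have := SWellFormed.concat (sWellFormed_of_neutral hu)
      (SWellFormed.concat (SWellFormed.wrap hx hy ih) (sWellFormed_of_neutral hv))
    rw [pw_succ, pw_succ']
    simpa using this

lemma matched_of_split {K : ℕ} {A : Type} {h : CRAlphabet K A} {s : Fin K} {x y : A}
    {w P u S : List A} (hw : w = P ++ x :: (u ++ y :: S)) (hx : x ∈ h.callSet s)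
    (hy : y ∈ h.retSet s) (hu : SWellFormed (h.callSet s) (h.retSet s) u) :
    Matched h w s P.length (P.length + 1 + u.length) := by
  subst hw
  refine ⟨by omega, by simp; omega, ⟨x, by simp, hx⟩, ⟨y, ?_, hy⟩, ?_⟩
  · rw [List.getElem?_append_right (by omega),
      show P.length + 1 + u.length - P.length = u.length + 1 by omega, List.getElem?_cons_succ,
      List.getElem?_append_right (by omega)]
    simp
  · convert hu using 1
    rw [show P.length + 1 + u.length = P.length + (u.length + 1) by omega,
      List.take_length_add_append, List.take_succ_cons, List.take_left, List.drop_length_add_append]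
    rfl

lemma matched_pw_pw {h : CRAlphabet 2 L2} {s : Fin 2} {x y : L2} {P u v S : List L2}
    (hx : x ∈ h.callSet s) (hy : y ∈ h.retSet s)
    (hu : ∀ z ∈ u, z ∉ h.callSet s ∧ z ∉ h.retSet s)
    (hv : ∀ z ∈ v, z ∉ h.callSet s ∧ z ∉ h.retSet s) {N M t : ℕ} (hN : t < N) (hM : t < M) :
    Matched h (P ++ (pw (u ++ [x]) N ++ (pw (y :: v) M ++ S))) s
      (P.length + (N - 1 - t) * (u.length + 1) + u.length)
      (P.length + N * (u.length + 1) + t * (v.length + 1)) := by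
  obtain ⟨p, rfl⟩ : ∃ p, N = p + 1 + t := ⟨N - 1 - t, by omega⟩
  obtain ⟨q, rfl⟩ : ∃ q, M = t + (q + 1) := ⟨M - 1 - t, by omega⟩
  have := matched_of_split (h := h) (s := s)
    (P := P ++ (pw (u ++ [x]) p ++ u)) (S := v ++ (pw (y :: v) q ++ S))
    (w := P ++ (pw (u ++ [x]) (p + 1 + t) ++ (pw (y :: v) (t + (q + 1)) ++ S)))
    (by rw [pw_add _ (p + 1), pw_succ', pw_add _ t, pw_succ]; simp) hx hy
    (sWellFormed_pw_pw hx hy hu hv t)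
  convert this using 1
  · simp [length_pw]; omega
  · simp [length_pw]; ring

/-- The call letter of the `j`-th column. -/
def callLetter (j : ℕ) : L2 := if j % 2 = 0 then .a else .b

/-- The return letter matching the calls of the `j`-th column. -/
def retLetter (j : ℕ) : L2 := if j % 2 = 0 then .abar else .bbar

/-- The stack used by the calls of the `j`-th column. -/
def stack (j : ℕ) : Fin 2 := if j % 2 = 0 then 0 else 1

lemma callLetter_mem_callSet {i j : ℕ} :
    callLetter i ∈ h2.callSet (stack j) ↔ i % 2 = j % 2 := by
  rcases Nat.mod_two_eq_zero_or_one i with hi | hi <;>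
  rcases Nat.mod_two_eq_zero_or_one j with hj | hj <;>
  simp [callLetter, stack, CRAlphabet.callSet, h2, hi, hj]

lemma retLetter_mem_retSet {i j : ℕ} :
    retLetter i ∈ h2.retSet (stack j) ↔ i % 2 = j % 2 := by
  rcases Nat.mod_two_eq_zero_or_one i with hi | hi <;>
  rcases Nat.mod_two_eq_zero_or_one j with hj | hj <;>
  simp [retLetter, stack, CRAlphabet.retSet, h2, hi, hj]

lemma callLetter_notMem_retSet (i : ℕ) (s : Fin 2) : callLetter i ∉ h2.retSet s := by
  rcases Nat.mod_two_eq_zero_or_one i with hi | hi <;>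
  simp [callLetter, CRAlphabet.retSet, h2, hi]

lemma retLetter_notMem_callSet (i : ℕ) (s : Fin 2) : retLetter i ∉ h2.callSet s := by
  rcases Nat.mod_two_eq_zero_or_one i with hi | hi <;>
  simp [retLetter, CRAlphabet.callSet, h2, hi]

lemma callLetter_ne_retLetter (i j : ℕ) : callLetter i ≠ retLetter j := by
  unfold callLetter retLetter
  split_ifs <;> simp

lemma callLetter_inj {i j : ℕ} : callLetter i = callLetter j ↔ i % 2 = j % 2 := by
  rcases Nat.mod_two_eq_zero_or_one i with hi | hi <;>
  rcases Nat.mod_two_eq_zero_or_one j with hj | hj <;> simp [callLetter, hi, hj]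

lemma retLetter_inj {i j : ℕ} : retLetter i = retLetter j ↔ i % 2 = j % 2 := by
  rcases Nat.mod_two_eq_zero_or_one i with hi | hi <;>
  rcases Nat.mod_two_eq_zero_or_one j with hj | hj <;> simp [retLetter, hi, hj]

/-- The letters preceding the call in the repeated unit of block `j`. -/
def unitPre : ℕ → List L2
  | 0 => []
  | j + 1 => [retLetter j]

/-- Blocks `0, …, j - 1`, where block `i` consists of `f i` repeated units. -/
def body (f : ℕ → ℕ) : ℕ → List L2
  | 0 => []
  | j + 1 => body f j ++ pw (unitPre j ++ [callLetter j]) (f j)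

/-- The word with call blocks `0, …, m` of sizes `f 0, …, f m`, followed by a block of
`f (m + 1)` returns. -/
def blockWord (f : ℕ → ℕ) (m : ℕ) : List L2 :=
  body f (m + 1) ++ pw [retLetter m] (f (m + 1))

lemma body_congr {f g : ℕ → ℕ} {j : ℕ} (h : ∀ i < j, f i = g i) : body f j = body g j := by
  induction j with
  | zero => rfl
  | succ j ih => rw [body, body, ih fun i hi => h i (by omega), h j (by omega)]

lemma blockWord_congr {f g : ℕ → ℕ} {m : ℕ} (h : ∀ i ≤ m + 1, f i = g i) :
    blockWord f m = blockWord g m := by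
  rw [blockWord, blockWord, body_congr fun i hi => h i (by omega), h _ le_rfl]

/-- The position at which block `j` starts. -/
def start (f : ℕ → ℕ) (j : ℕ) : ℕ := (body f j).length

/-- The position of the `i`-th call of block `j`. -/
def callPos (f : ℕ → ℕ) (j i : ℕ) : ℕ :=
  start f j + i * ((unitPre j).length + 1) + (unitPre j).length

/-- The letters following the return in the repeated unit of block `j + 1`. -/
def retPost (m j : ℕ) : List L2 := if j < m then [callLetter (j + 1)] else []

/-- The position of the `t`-th return of block `j + 1`. -/
def retPos (f : ℕ → ℕ) (m j t : ℕ) : ℕ :=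
  start f (j + 1) + t * ((retPost m j).length + 1)

lemma start_zero (f : ℕ → ℕ) : start f 0 = 0 := rfl

lemma start_succ (f : ℕ → ℕ) (j : ℕ) :
    start f (j + 1) = start f j + f j * ((unitPre j).length + 1) := by
  simp [start, body, length_pw]

lemma start_one (f : ℕ → ℕ) : start f 1 = f 0 := by
  simp [start_succ, start_zero, unitPre]

lemma start_add_two (f : ℕ → ℕ) (j : ℕ) :
    start f (j + 2) = start f (j + 1) + 2 * f (j + 1) := by
  rw [start_succ]; simp [unitPre]; ring

lemma start_mono (f : ℕ → ℕ) {i j : ℕ} (h : i ≤ j) : start f i ≤ start f j := by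
  induction h with
  | refl => rfl
  | step _ ih => exact ih.trans (by rw [start_succ]; omega)

lemma callPos_zero (f : ℕ → ℕ) (i : ℕ) : callPos f 0 i = i := by
  simp [callPos, start_zero, unitPre]

lemma callPos_succ (f : ℕ → ℕ) (j i : ℕ) :
    callPos f (j + 1) i = start f (j + 1) + 2 * i + 1 := by
  simp [callPos, unitPre]; ring

lemma retPos_of_lt (f : ℕ → ℕ) {m j : ℕ} (h : j < m) (t : ℕ) :
    retPos f m j t = start f (j + 1) + 2 * t := by
  simp [retPos, retPost, h]; ring

lemma retPos_self (f : ℕ → ℕ) (m t : ℕ) : retPos f m m t = start f (m + 1) + t := by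
  simp [retPos, retPost]

lemma length_blockWord (f : ℕ → ℕ) (m : ℕ) :
    (blockWord f m).length = start f (m + 1) + f (m + 1) := by
  simp [blockWord, start, length_pw]

lemma body_isPrefix (f : ℕ → ℕ) {i j : ℕ} (h : i ≤ j) : body f i <+: body f j := by
  induction h with
  | refl => exact List.prefix_rfl
  | step _ ih => exact ih.trans ⟨_, rfl⟩

lemma exists_blockWord_eq (f : ℕ → ℕ) {m j : ℕ} (h : j ≤ m) :
    ∃ S, blockWord f m = body f j ++ (pw (unitPre j ++ [callLetter j]) (f j) ++
      (pw (retLetter j :: retPost m j) (f (j + 1)) ++ S)) := by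
  rcases h.lt_or_eq with h | rfl
  · obtain ⟨S, hS⟩ := body_isPrefix f (show j + 2 ≤ m + 1 by omega)
    refine ⟨S ++ pw [retLetter m] (f (m + 1)), ?_⟩
    rw [blockWord, ← hS]
    simp [body, retPost, h, unitPre]
  · exact ⟨[], by simp [blockWord, body, retPost]⟩

lemma matched_callPos_retPos {f : ℕ → ℕ} {m j t : ℕ} (hj : j ≤ m) (ht : t < f j)
    (ht' : t < f (j + 1)) :
    Matched h2 (blockWord f m) (stack j) (callPos f j (f j - 1 - t)) (retPos f m j t) := by
  obtain ⟨S, hS⟩ := exists_blockWord_eq f hj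
  rw [hS, callPos, retPos, start_succ]
  refine matched_pw_pw (callLetter_mem_callSet.2 rfl) (retLetter_mem_retSet.2 rfl) ?_ ?_ ht ht'
  · intro z hz
    cases j with
    | zero => simp [unitPre] at hz
    | succ j =>
      simp only [unitPre, List.mem_singleton] at hz
      subst hz
      refine ⟨retLetter_notMem_callSet _ _, ?_⟩
      rw [retLetter_mem_retSet]
      omega
  · intro z hz
    unfold retPost at hz
    split_ifs at hz
    · rw [List.mem_singleton] at hz
      subst hz
      refine ⟨?_, callLetter_notMem_retSet _ _⟩
      rw [callLetter_mem_callSet]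
      omega
    · simp at hz

lemma getElem?_callPos {f : ℕ → ℕ} {m j i : ℕ} (hj : j ≤ m) (hi : i < f j) :
    (blockWord f m)[callPos f j i]? = some (callLetter j) := by
  obtain ⟨S, hS⟩ := exists_blockWord_eq f hj
  have hlt : i * ((unitPre j).length + 1) + (unitPre j).length
      < (pw (unitPre j ++ [callLetter j]) (f j)).length := by
    rw [length_pw]
    simp only [List.length_append, List.length_singleton]
    nlinarith
  rw [hS, callPos, start, Nat.add_assoc, List.getElem?_append_right (by omega),
    Nat.add_sub_cancel_left, List.getElem?_append_left hlt]
  have := getElem?_pw (unitPre j ++ [callLetter j]) hi (e := (unitPre j).length) (by simp)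
  simpa using this

lemma getElem?_retPos {f : ℕ → ℕ} {m j t : ℕ} (hj : j ≤ m) (ht : t < f (j + 1)) :
    (blockWord f m)[retPos f m j t]? = some (retLetter j) := by
  obtain ⟨S, hS⟩ := exists_blockWord_eq f hj
  have hb : body f (j + 1) = body f j ++ pw (unitPre j ++ [callLetter j]) (f j) := rfl
  have hlt : t * ((retPost m j).length + 1)
      < (pw (retLetter j :: retPost m j) (f (j + 1))).length := by
    rw [length_pw]
    simp only [List.length_cons]
    nlinarith
  rw [hS, ← List.append_assoc, ← hb, retPos, start, List.getElem?_append_right (by omega),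
    Nat.add_sub_cancel_left, List.getElem?_append_left hlt]
  have := getElem?_pw (retLetter j :: retPost m j) ht (e := 0) (by simp)
  simpa using this

lemma decode_of_lt_start {f : ℕ → ℕ} {m p : ℕ} : ∀ {j : ℕ}, j ≤ m + 1 → p < start f j →
    (∃ j ≤ m, ∃ i < f j, p = callPos f j i) ∨
      ∃ j ≤ m, ∃ t < f (j + 1), p = retPos f m j t
  | 0, _, hp => by simp [start_zero] at hp
  | j + 1, hj, hp => by
    by_cases hpj : p < start f j
    · exact decode_of_lt_start (by omega) hpj
    rcases j with _ | j
    · rw [start_one] at hp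
      exact .inl ⟨0, by omega, p, hp, (callPos_zero _ _).symm⟩
    · rw [start_add_two] at hp
      rcases Nat.even_or_odd' (p - start f (j + 1)) with ⟨k, hk | hk⟩
      · exact .inr ⟨j, by omega, k, by omega, by rw [retPos_of_lt _ (by omega)]; omega⟩
      · exact .inl ⟨j + 1, by omega, k, by omega, by rw [callPos_succ]; omega⟩

lemma decode {f : ℕ → ℕ} {m p : ℕ} (hp : p < (blockWord f m).length) :
    (∃ j ≤ m, ∃ i < f j, p = callPos f j i) ∨
      ∃ j ≤ m, ∃ t < f (j + 1), p = retPos f m j t := by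
  rw [length_blockWord] at hp
  by_cases h : p < start f (m + 1)
  · exact decode_of_lt_start le_rfl h
  · exact .inr ⟨m, le_rfl, p - start f (m + 1), by omega, by rw [retPos_self]; omega⟩

lemma getElem?_left_of_muAny {w : List L2} {x y j : ℕ} (h : MuAny h2 w x y) :
    w[x]? ≠ some (retLetter j) := by
  obtain ⟨s, -, -, ⟨c, hc, hcc⟩, -⟩ := h
  rw [hc]
  rintro ⟨⟩
  exact retLetter_notMem_callSet _ _ hcc

lemma getElem?_right_of_muAny {w : List L2} {x y j : ℕ} (h : MuAny h2 w x y) :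
    w[y]? ≠ some (callLetter j) := by
  obtain ⟨s, -, -, -, ⟨c, hc, hcc⟩, -⟩ := h
  rw [hc]
  rintro ⟨⟩
  exact callLetter_notMem_retSet _ _ hcc

lemma muAny_parity {w : List L2} {x y i j : ℕ} (h : MuAny h2 w x y)
    (hx : w[x]? = some (callLetter i)) (hy : w[y]? = some (retLetter j)) : i % 2 = j % 2 := by
  obtain ⟨s, -, -, ⟨c, hc, hcc⟩, ⟨r, hr, hrr⟩, -⟩ := h
  rw [hx] at hc
  rw [hy] at hr
  cases hc
  cases hr
  obtain ⟨k, rfl⟩ : ∃ k, s = stack k := by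
    fin_cases s
    exacts [⟨0, rfl⟩, ⟨1, rfl⟩]
  exact (callLetter_mem_callSet.1 hcc).trans (retLetter_mem_retSet.1 hrr).symm

lemma lt_of_muAny {w : List L2} {x y : ℕ} (h : MuAny h2 w x y) : x < y ∧ y < w.length :=
  h.elim fun _ h => ⟨h.1, h.2.1⟩

lemma allMatched_blockWord_const (n m : ℕ) : AllMatched (blockWord (fun _ => n) m) := by
  intro p hp
  rcases decode hp with ⟨j, hj, i, hi, rfl⟩ | ⟨j, hj, t, ht, rfl⟩
  · have := matched_callPos_retPos (f := fun _ => n) hj (t := n - 1 - i)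
      (show n - 1 - i < n by omega) (show n - 1 - i < n by omega)
    rw [show n - 1 - (n - 1 - i) = i by omega] at this
    exact ⟨_, .inl ⟨_, this⟩⟩
  · exact ⟨_, .inr ⟨_, matched_callPos_retPos hj ht ht⟩⟩

lemma exists_of_muAny_blockWord_const {n m x y : ℕ}
    (h : MuAny h2 (blockWord (fun _ => n) m) x y) :
    ∃ j ≤ m, ∃ i < n, x = callPos (fun _ => n) j i ∧
      y = retPos (fun _ => n) m j (n - 1 - i) := by
  obtain ⟨h1, h2'⟩ := lt_of_muAny h
  rcases decode (h1.trans h2') with ⟨j, hj, i, hi, rfl⟩ | ⟨j, hj, t, ht, rfl⟩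
  · have := matched_callPos_retPos (f := fun _ => n) hj (t := n - 1 - i)
      (show n - 1 - i < n by omega) (show n - 1 - i < n by omega)
    rw [show n - 1 - (n - 1 - i) = i by omega] at this
    exact ⟨j, hj, i, hi, rfl, muAny_unique h ⟨_, this⟩⟩
  · exact absurd (getElem?_retPos hj ht) (getElem?_left_of_muAny h)

lemma consistent_blockWord_const {n : ℕ} (hn : 1 ≤ n) (m : ℕ) :
    Consistent (blockWord (fun _ => n) m) := by
  intro x₁ y₁ x₂ y₂ h₁ h₂ hx
  obtain ⟨j₁, hj₁, i₁, hi₁, rfl, rfl⟩ := exists_of_muAny_blockWord_const h₁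
  obtain ⟨j₂, hj₂, i₂, hi₂, rfl, rfl⟩ := exists_of_muAny_blockWord_const h₂
  have hy₁ := getElem?_retPos (f := fun _ => n) hj₁ (t := n - 1 - i₁)
    (show n - 1 - i₁ < n by omega)
  have hx₁ := getElem?_callPos (f := fun _ => n) hj₁ hi₁
  have hx₂ := getElem?_callPos (f := fun _ => n) hj₂ hi₂
  have hpar : j₁ % 2 = j₂ % 2 := by
    rw [hx₁, hx₂] at hx
    exact callLetter_inj.1 (Option.some_injective _ hx)
  -- different columns using the same stack are far apart
  have far : ∀ k l a b s t, k + 2 ≤ l → l ≤ m → a < n → b < n → s < n → t < n →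
      callPos (fun _ => n) k a + 3 ≤ callPos (fun _ => n) l b ∧
      retPos (fun _ => n) m k s + 3 ≤ retPos (fun _ => n) m l t := by
    intro k l a b s t hkl hl ha hb hs ht
    have e1 := start_add_two (fun _ => n) k
    have e2 := start_add_two (fun _ => n) (k + 1)
    have e3 := start_mono (fun _ => n) hkl
    have e4 := start_mono (fun _ => n) (show k + 3 ≤ l + 1 by omega)
    have e5 := retPos_of_lt (fun _ => n) (show k < m by omega) s
    have e6 : start (fun _ => n) (l + 1) ≤ retPos (fun _ => n) m l t := by
      rw [retPos]; omega
    obtain ⟨l, rfl⟩ : ∃ l', l = l' + 1 := ⟨l - 1, by omega⟩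
    have e7 := callPos_succ (fun _ => n) l b
    rcases k with _ | k
    · have e8 := callPos_zero (fun _ => n) a
      have e9 := start_one (fun _ => n)
      simp only [zero_add, add_assoc, Nat.reduceAdd] at *
      omega
    · have e8 := callPos_succ (fun _ => n) k a
      have e9 := start_add_two (fun _ => n) k
      simp only [add_assoc, Nat.reduceAdd] at *
      omega
  rcases lt_trichotomy j₁ j₂ with hlt | rfl | hlt
  · have := far j₁ j₂ i₁ i₂ (n - 1 - i₁) (n - 1 - i₂) (by omega) hj₂ hi₁ hi₂ (by omega) (by omega)
    refine ⟨?_, ?_, ?_, ?_, ?_⟩ <;> intros <;> omega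
  · have hmid (h : i₁ + 1 < n) := getElem?_callPos (f := fun _ => n) hj₁ h
    have hret (h : n - 1 - i₂ + 1 < n) := getElem?_retPos (f := fun _ => n) hj₁ h
    have hy₂ := getElem?_retPos (f := fun _ => n) hj₁ (t := n - 1 - i₂)
      (show n - 1 - i₂ < n by omega)
    rcases j₁ with _ | j₁
    · simp only [callPos_zero] at *
      rcases hj₁.eq_or_lt with rfl | hm
      · simp only [retPos_self] at *
        refine ⟨?_, ?_, ?_, ?_, ?_⟩ <;> intros
        any_goals omega
        simp_all [retLetter]
      · simp only [retPos_of_lt _ hm] at *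
        refine ⟨?_, ?_, ?_, ?_, ?_⟩ <;> intros
        any_goals omega
        rename_i h1 h2
        exact absurd ((hmid (by omega)).trans hx₁.symm) h2
    · simp only [callPos_succ] at *
      rcases hj₁.eq_or_lt with rfl | hm
      · simp only [retPos_self] at *
        refine ⟨?_, ?_, ?_, ?_, ?_⟩ <;> intros
        any_goals omega
        rename_i h1 h2
        refine absurd (Eq.trans ?_ hy₂.symm) h2
        rw [← hret (by omega)]
        congr 1
      · simp only [retPos_of_lt _ hm] at *
        refine ⟨?_, ?_, ?_, ?_, ?_⟩ <;> intros <;> omega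
  · have := far j₂ j₁ i₂ i₁ (n - 1 - i₂) (n - 1 - i₁) (by omega) hj₁ hi₂ hi₁ (by omega) (by omega)
    refine ⟨?_, ?_, ?_, ?_, ?_⟩ <;> intros <;> omega

lemma blockSize_succ_eq {f : ℕ → ℕ} {m : ℕ} (hf : ∀ i, 1 ≤ f i)
    (hm : AllMatched (blockWord f m)) (hc : Consistent (blockWord f m)) {j : ℕ} (hj : j ≤ m)
    (ih : ∀ i < j, f (i + 1) = f i) : f (j + 1) = f j := by
  have hfj := hf j
  have hfj' := hf (j + 1)
  rcases lt_trichotomy (f (j + 1)) (f j) with hlt | h | hlt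
  · exfalso
    set k := f (j + 1) with hk
    have hx₁ : (blockWord f m)[callPos f j (f j - 1 - k)]? = some (callLetter j) :=
      getElem?_callPos hj (by omega)
    have hx₂ : (blockWord f m)[callPos f j (f j - 1 - (k - 1))]? = some (callLetter j) :=
      getElem?_callPos hj (by omega)
    have h₂ : MuAny h2 (blockWord f m) _ _ :=
      ⟨_, matched_callPos_retPos (f := f) hj (t := k - 1) (by omega) (by omega)⟩
    obtain ⟨y, h₁ | h₁⟩ := hm _ (List.getElem?_eq_some_iff.1 hx₁).1
    swap
    · exact getElem?_right_of_muAny h₁ hx₁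
    have key : y = retPos f m j (k - 1) + 1 ∨ y = retPos f m j (k - 1) + 2 := by
      obtain ⟨c1, -, -, c4, -⟩ := hc _ _ _ _ h₁ h₂ (hx₁.trans hx₂.symm)
      rcases j with _ | j
      · refine c1 hx₁ ?_
        rw [callPos_zero, callPos_zero]
        omega
      · refine c4 ?_ ?_
        · rw [callPos_succ, callPos_succ]
          omega
        · have := getElem?_retPos (f := f) (show j ≤ m by omega) (t := f (j + 1) - k)
            (by omega)
          rw [retPos_of_lt _ (by omega)] at this
          rw [hx₁, callPos_succ, show start f (j + 1) + 2 * (f (j + 1) - 1 - k) + 1 + 1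
            = start f (j + 1) + 2 * (f (j + 1) - k) by omega, this]
          exact fun h => callLetter_ne_retLetter _ _ (Option.some_injective _ h).symm
    have hlen := (lt_of_muAny h₁).2
    rcases hj.eq_or_lt with rfl | hjm
    · rw [retPos_self] at key
      rw [length_blockWord] at hlen
      omega
    · rw [retPos_of_lt _ hjm] at key
      rcases key with rfl | rfl
      · have := getElem?_callPos (f := f) (show j + 1 ≤ m from hjm) (i := k - 1) (by omega)
        rw [callPos_succ] at this
        exact getElem?_right_of_muAny h₁ this
      · have := getElem?_retPos (f := f) (show j + 1 ≤ m from hjm) (t := 0) (hf _)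
        rw [retPos, zero_mul, add_zero, start_add_two, show start f (j + 1) + 2 * f (j + 1) =
          start f (j + 1) + 2 * (k - 1) + 2 by omega] at this
        have := muAny_parity h₁ hx₁ this
        omega
  · exact h
  · exfalso
    have hy := getElem?_retPos (f := f) hj hlt
    obtain ⟨x, h | h⟩ := hm _ (List.getElem?_eq_some_iff.1 hy).1
    · exact getElem?_left_of_muAny h hy
    obtain ⟨hxy, hlen⟩ := lt_of_muAny h
    rcases decode (hxy.trans hlen) with ⟨i, hi, e, he, rfl⟩ | ⟨i, hi, t, ht, rfl⟩
    swap
    · exact getElem?_left_of_muAny h (getElem?_retPos hi ht)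
    have hpar := muAny_parity h (getElem?_callPos hi he) hy
    have hbound : retPos f m j (f j) < start f (j + 2) := by
      rw [start_add_two]
      rcases hj.eq_or_lt with rfl | hjm
      · rw [retPos_self]; omega
      · rw [retPos_of_lt _ hjm]; omega
    have hij : i ≤ j := by
      by_contra hij
      have := start_mono f (show j + 2 ≤ i by omega)
      unfold callPos at hxy
      omega
    have hle : f i ≤ f (i + 1) := by
      rcases hij.eq_or_lt with rfl | hij
      · exact hlt.le
      · exact (ih i hij).ge
    have h' := matched_callPos_retPos (f := f) hi (t := f i - 1 - e) (by omega) (by omega)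
    rw [show f i - 1 - (f i - 1 - e) = e by omega] at h'
    have heq := muAny_unique h ⟨_, h'⟩
    rcases hij.eq_or_lt with rfl | hij
    · rcases hj.eq_or_lt with rfl | hjm
      · rw [retPos_self, retPos_self] at heq; omega
      · rw [retPos_of_lt _ hjm, retPos_of_lt _ hjm] at heq; omega
    · have := start_mono f (show i + 2 ≤ j + 1 by omega)
      rw [start_add_two] at this
      rw [retPos_of_lt _ (show i < m by omega), retPos] at heq
      omega

lemma blockSize_eq {f : ℕ → ℕ} {m : ℕ} (hf : ∀ i, 1 ≤ f i)
    (hm : AllMatched (blockWord f m)) (hc : Consistent (blockWord f m)) :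
    ∀ j ≤ m + 1, f j = f 0 := by
  have hs : ∀ j ≤ m, f (j + 1) = f j := by
    intro j
    induction j using Nat.strong_induction_on with
    | _ j ih => exact fun hj => blockSize_succ_eq hf hm hc hj fun i hi => ih i hi (by omega)
  intro j
  induction j with
  | zero => exact fun _ => rfl
  | succ j ih => exact fun hj => (hs j (by omega)).trans (ih (by omega))

lemma body_odd (f : ℕ → ℕ) (k : ℕ) : body f (2 * k + 1) = pw [L2.a] (f 0) ++
    ((List.range k).map fun i =>
      pw [L2.abar, L2.b] (f (2 * i + 1)) ++ pw [L2.bbar, L2.a] (f (2 * i + 2))).flatten := by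
  induction k with
  | zero => simp [body, unitPre, callLetter]
  | succ k ih =>
    rw [show 2 * (k + 1) + 1 = 2 * k + 1 + 1 + 1 by ring, body, body, ih, List.range_succ]
    simp [unitPre, callLetter, retLetter, Nat.add_mod, List.append_assoc]

lemma blockWord_even (f : ℕ → ℕ) (k : ℕ) : blockWord f (2 * k) = pw [L2.a] (f 0) ++
    ((List.range k).map fun i =>
      pw [L2.abar, L2.b] (f (2 * i + 1)) ++ pw [L2.bbar, L2.a] (f (2 * i + 2))).flatten ++
    pw [L2.abar] (f (2 * k + 1)) := by
  rw [blockWord, body_odd, retLetter, if_pos (by omega)]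

lemma blockWord_odd (f : ℕ → ℕ) (k : ℕ) : blockWord f (2 * k + 1) = pw [L2.a] (f 0) ++
    ((List.range k).map fun i =>
      pw [L2.abar, L2.b] (f (2 * i + 1)) ++ pw [L2.bbar, L2.a] (f (2 * i + 2))).flatten ++
    pw [L2.abar, L2.b] (f (2 * k + 1)) ++ pw [L2.bbar] (f (2 * k + 2)) := by
  rw [blockWord, body, body_odd]
  simp [unitPre, callLetter, retLetter, Nat.add_mod]

lemma encodeGrid_succ (n m : ℕ) : encodeGrid n (m + 1) = blockWord (fun _ => n) m := by
  rcases Nat.even_or_odd' m with ⟨k, rfl | rfl⟩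
  · rw [blockWord_even, encodeGrid, if_pos (by omega), show (2 * k + 1 - 1) / 2 = k by omega,
      List.map_const', List.length_range]
    rfl
  · rw [blockWord_odd, encodeGrid, if_neg (by omega), show (2 * k + 1 + 1) / 2 - 1 = k by omega,
      List.map_const', List.length_range]
    rfl

lemma regexCond_blockWord {f : ℕ → ℕ} (hf : ∀ i, 1 ≤ f i) (m : ℕ) :
    RegexCond (blockWord f m) := by
  have hb (k : ℕ) : ∀ u ∈ (List.range k).map fun i =>
      pw [L2.abar, L2.b] (f (2 * i + 1)) ++ pw [L2.bbar, L2.a] (f (2 * i + 2)), ABBlock u := by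
    intro u hu
    obtain ⟨i, -, rfl⟩ := List.mem_map.1 hu
    exact ⟨_, _, hf _, hf _, rfl⟩
  rcases Nat.even_or_odd' m with ⟨k, rfl | rfl⟩
  · exact .inl ⟨_, hf 0, _, hb k, _, hf _, blockWord_even f k⟩
  · exact .inr ⟨_, hf 0, _, hb k, _, hf _, _, hf _, blockWord_odd f k⟩

lemma body_update {f : ℕ → ℕ} (i j k : ℕ) (h : i ≤ j) :
    body (Function.update f j k) i = body f i :=
  body_congr fun l hl => Function.update_of_ne (by omega) _ _

lemma one_le_update {f : ℕ → ℕ} (hf : ∀ i, 1 ≤ f i) (j : ℕ) {k : ℕ} (hk : 1 ≤ k) :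
    ∀ i, 1 ≤ Function.update f j k i := by
  intro i
  rw [Function.update_apply]
  split_ifs
  exacts [hk, hf i]

lemma body_succ_update {f : ℕ → ℕ} (j k : ℕ) :
    body (Function.update f j k) (j + 1) = body f j ++ pw (unitPre j ++ [callLetter j]) k := by
  rw [body, body_update _ _ _ le_rfl, Function.update_self]

lemma blockWord_update {f : ℕ → ℕ} (m k : ℕ) :
    blockWord (Function.update f (m + 1) k) m = body f (m + 1) ++ pw [retLetter m] k := by
  rw [blockWord, body_update _ _ _ le_rfl, Function.update_self]

lemma exists_body_eq {p : ℕ} (hp : 1 ≤ p) (bs : List (List L2)) (hbs : ∀ u ∈ bs, ABBlock u) :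
    ∃ f : ℕ → ℕ, (∀ i, 1 ≤ f i) ∧
      pw [L2.a] p ++ bs.flatten = body f (2 * bs.length + 1) := by
  induction bs using List.reverseRecOn with
  | nil => exact ⟨fun _ => p, fun _ => hp, by simp [body, unitPre, callLetter]⟩
  | append_singleton bs u ih =>
    obtain ⟨f, hf, hfe⟩ := ih fun u hu => hbs u (by simp [hu])
    obtain ⟨k, l, hk, hl, rfl⟩ := hbs u (by simp)
    refine ⟨Function.update (Function.update f (2 * bs.length + 1) k) (2 * bs.length + 2) l,
      one_le_update (one_le_update hf _ hk) _ hl, ?_⟩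
    rw [List.length_append, List.length_singleton,
      show 2 * (bs.length + 1) + 1 = 2 * bs.length + 2 + 1 by ring, body_succ_update,
      body_succ_update, ← hfe]
    simp [unitPre, callLetter, retLetter, Nat.add_mod]

lemma RegexCond.exists_blockWord {w : List L2} (h : RegexCond w) :
    ∃ (m : ℕ) (f : ℕ → ℕ), (∀ i, 1 ≤ f i) ∧ w = blockWord f m := by
  rcases h with ⟨p, hp, bs, hbs, q, hq, rfl⟩ | ⟨p, hp, bs, hbs, k, hk, q, hq, rfl⟩
  · obtain ⟨f, hf, hfe⟩ := exists_body_eq hp bs hbs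
    refine ⟨2 * bs.length, Function.update f (2 * bs.length + 1) q, one_le_update hf _ hq, ?_⟩
    rw [hfe, blockWord_update, retLetter, if_pos (by omega)]
  · obtain ⟨f, hf, hfe⟩ := exists_body_eq hp bs hbs
    refine ⟨2 * bs.length + 1,
      Function.update (Function.update f (2 * bs.length + 1) k) (2 * bs.length + 1 + 1) q,
      one_le_update (one_le_update hf _ hk) _ hq, ?_⟩
    rw [hfe, blockWord_update, body_succ_update]
    simp [unitPre, callLetter, retLetter, Nat.add_mod]

lemma exists_encodeGrid_iff (w : List L2) : (∃ n m, 1 ≤ n ∧ 1 ≤ m ∧ w = encodeGrid n m) ↔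
    RegexCond w ∧ AllMatched w ∧ Consistent w := by
  constructor
  · rintro ⟨n, m, hn, hm, rfl⟩
    obtain ⟨m, rfl⟩ := Nat.exists_eq_add_of_le' hm
    rw [encodeGrid_succ]
    exact ⟨regexCond_blockWord (fun _ => hn) m, allMatched_blockWord_const n m,
      consistent_blockWord_const hn m⟩
  · rintro ⟨hr, hm, hc⟩
    obtain ⟨m, f, hf, rfl⟩ := RegexCond.exists_blockWord hr
    exact ⟨f 0, m + 1, hf 0, by omega, by
      rw [encodeGrid_succ, blockWord_congr (blockSize_eq hf hm hc)]⟩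

/-- The letters that may follow two given consecutive letters. -/
def okTriple : L2 → L2 → L2 → Bool
  | .a, .a, .a => true
  | .a, .a, .abar => true
  | .bbar, .a, .bbar => true
  | .bbar, .a, .abar => true
  | .a, .abar, .b => true
  | .a, .abar, .abar => true
  | .b, .abar, .b => true
  | .abar, .abar, .abar => true
  | .abar, .b, .abar => true
  | .abar, .b, .bbar => true
  | .b, .bbar, .a => true
  | .b, .bbar, .bbar => true
  | .a, .bbar, .a => true
  | .bbar, .bbar, .bbar => true
  | _, _, _ => false

/-- The pairs of letters with which a word may end. -/
def okLast : L2 → L2 → Bool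
  | .a, .abar => true
  | .abar, .abar => true
  | .b, .bbar => true
  | .bbar, .bbar => true
  | _, _ => false

/-- `Run p c t`: the word `t` is a legal continuation after the letters `p, c`. -/
def Run : L2 → L2 → List L2 → Prop
  | p, c, [] => okLast p c = true
  | p, c, d :: t => okTriple p c d = true ∧ Run c d t

/-- A letter that precedes the last letter of blocks `0, …, j`, where the first block is
regarded as preceded by an `a`. -/
def prevLetter : ℕ → L2
  | 0 => .a
  | j + 1 => retLetter j

/-- The word `u` has been read, with last letters `p, c` (a leading `a` being added). -/
def RunInv (p c : L2) (u : List L2) : Prop :=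
  ∃ (j : ℕ) (f : ℕ → ℕ), (∀ i, 1 ≤ f i) ∧
    ((p = prevLetter j ∧ c = callLetter j ∧ u = body f (j + 1)) ∨
      (p = callLetter j ∧ c = retLetter j ∧ u = body f (j + 1) ++ [retLetter j]) ∨
      (p = callLetter (j + 1) ∧ c = retLetter j ∧ u = body f (j + 2) ++ [retLetter j]) ∨
      (p = retLetter j ∧ c = retLetter j ∧
        ∃ k, 1 ≤ k ∧ u = body f (j + 1) ++ pw [retLetter j] k))

lemma letters_cases (j : ℕ) :
    (callLetter j = .a ∧ retLetter j = .abar ∧ callLetter (j + 1) = .b ∧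
      retLetter (j + 1) = .bbar) ∨
    (callLetter j = .b ∧ retLetter j = .bbar ∧ callLetter (j + 1) = .a ∧
      retLetter (j + 1) = .abar) := by
  rcases Nat.mod_two_eq_zero_or_one j with h | h <;>
  simp [callLetter, retLetter, h, Nat.add_mod]

lemma body_extend (f : ℕ → ℕ) (j : ℕ) : body (Function.update f j (f j + 1)) (j + 1) =
    body f (j + 1) ++ (unitPre j ++ [callLetter j]) := by
  rw [body_succ_update, pw_succ', body, List.append_assoc]

lemma RunInv.exists_blockWord {p c : L2} {u : List L2} (h : RunInv p c u)
    (hl : okLast p c = true) :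
    ∃ (m : ℕ) (f : ℕ → ℕ), (∀ i, 1 ≤ f i) ∧ u = blockWord f m := by
  obtain ⟨j, f, hf, ⟨rfl, rfl, rfl⟩ | ⟨rfl, rfl, rfl⟩ | ⟨rfl, rfl, rfl⟩ |
    ⟨rfl, rfl, k, hk, rfl⟩⟩ := h
  · exfalso
    rcases j with _ | j
    · simp [prevLetter, callLetter, okLast] at hl
    · rcases letters_cases j with ⟨-, h1, h2, -⟩ | ⟨-, h1, h2, -⟩ <;>
      simp [prevLetter, h1, h2, okLast] at hl
  · exact ⟨j, Function.update f (j + 1) 1, one_le_update hf _ le_rfl, by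
      rw [blockWord_update]; rfl⟩
  · exfalso
    rcases letters_cases j with ⟨-, h1, h2, -⟩ | ⟨-, h1, h2, -⟩ <;>
    simp [h1, h2, okLast] at hl
  · exact ⟨j, Function.update f (j + 1) k, one_le_update hf _ hk, by rw [blockWord_update]⟩

lemma RunInv.step {p c d : L2} {u : List L2} (h : RunInv p c u)
    (hd : okTriple p c d = true) : RunInv c d (u ++ [d]) := by
  obtain ⟨j, f, hf, ⟨rfl, rfl, rfl⟩ | ⟨rfl, rfl, rfl⟩ | ⟨rfl, rfl, rfl⟩ |
    ⟨rfl, rfl, k, hk, rfl⟩⟩ := h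
  · rcases j with _ | j
    · have hd' : d = callLetter 0 ∨ d = retLetter 0 := by
        revert hd
        cases d <;> simp [prevLetter, callLetter, retLetter, okTriple]
      rcases hd' with rfl | rfl
      · exact ⟨0, Function.update f 0 (f 0 + 1), one_le_update hf _ (by omega),
          .inl ⟨rfl, rfl, by rw [body_extend]; rfl⟩⟩
      · exact ⟨0, f, hf, .inr <| .inl ⟨rfl, rfl, rfl⟩⟩
    · have hd' : d = retLetter j ∨ d = retLetter (j + 1) := by
        revert hd
        rcases letters_cases j with ⟨-, h1, h2, h3⟩ | ⟨-, h1, h2, h3⟩ <;>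
        cases d <;> simp [prevLetter, h1, h2, h3, okTriple]
      rcases hd' with rfl | rfl
      · exact ⟨j, f, hf, .inr <| .inr <| .inl ⟨rfl, rfl, rfl⟩⟩
      · exact ⟨j + 1, f, hf, .inr <| .inl ⟨rfl, rfl, rfl⟩⟩
  · have hd' : d = callLetter (j + 1) ∨ d = retLetter j := by
      revert hd
      rcases letters_cases j with ⟨h0, h1, h2, -⟩ | ⟨h0, h1, h2, -⟩ <;>
      cases d <;> simp [h0, h1, h2, okTriple]
    rcases hd' with rfl | rfl
    · exact ⟨j + 1, Function.update f (j + 1) 1, one_le_update hf _ le_rfl,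
        .inl ⟨rfl, rfl, by rw [body_succ_update]; simp [unitPre, pw]⟩⟩
    · exact ⟨j, f, hf, .inr <| .inr <| .inr ⟨rfl, rfl, 2, by omega, by simp [pw]⟩⟩
  · have hd' : d = callLetter (j + 1) := by
      revert hd
      rcases letters_cases j with ⟨-, h1, h2, -⟩ | ⟨-, h1, h2, -⟩ <;>
      cases d <;> simp [h1, h2, okTriple]
    subst hd'
    exact ⟨j + 1, Function.update f (j + 1) (f (j + 1) + 1), one_le_update hf _ (by omega),
      .inl ⟨rfl, rfl, by rw [body_extend]; simp [unitPre]⟩⟩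
  · have hd' : d = retLetter j := by
      revert hd
      rcases letters_cases j with ⟨-, h1, -⟩ | ⟨-, h1, -⟩ <;>
      cases d <;> simp [h1, okTriple]
    subst hd'
    exact ⟨j, f, hf, .inr <| .inr <| .inr ⟨rfl, rfl, k + 1, by omega, by
      rw [pw_succ', List.append_assoc]⟩⟩

lemma Run.exists_blockWord {p c : L2} {t u : List L2} (ht : Run p c t) (hu : RunInv p c u) :
    ∃ (m : ℕ) (f : ℕ → ℕ), (∀ i, 1 ≤ f i) ∧ u ++ t = blockWord f m := by
  induction t generalizing p c u with
  | nil => simpa using RunInv.exists_blockWord hu ht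
  | cons d t ih => simpa using ih ht.2 (RunInv.step hu ht.1)

lemma run_pw_call (j : ℕ) {t : List L2} (ht : Run (retLetter j) (callLetter (j + 1)) t) (k : ℕ) :
    Run (retLetter j) (callLetter (j + 1)) (pw [retLetter j, callLetter (j + 1)] k ++ t) := by
  induction k with
  | zero => exact ht
  | succ k ih =>
    rw [pw_succ]
    refine ⟨?_, ?_, ih⟩ <;>
    rcases letters_cases j with ⟨-, h1, h2, -⟩ | ⟨-, h1, h2, -⟩ <;> simp [h1, h2, okTriple]

lemma run_pw_ret (j k : ℕ) : Run (retLetter j) (retLetter j) (pw [retLetter j] k) := by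
  induction k with
  | zero => rcases letters_cases j with ⟨-, h1, -⟩ | ⟨-, h1, -⟩ <;> simp [h1, pw, Run, okLast]
  | succ k ih =>
    rw [pw_succ]
    refine ⟨?_, ih⟩
    rcases letters_cases j with ⟨-, h1, -⟩ | ⟨-, h1, -⟩ <;> simp [h1, okTriple]

lemma run_pw_a {t : List L2} (ht : Run .a .a t) (k : ℕ) : Run .a .a (pw [L2.a] k ++ t) := by
  induction k with
  | zero => exact ht
  | succ k ih => exact ⟨rfl, ih⟩

lemma okTriple_prevLetter (j : ℕ) :
    okTriple (prevLetter j) (callLetter j) (retLetter j) = true := by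
  rcases j with _ | j
  · rfl
  · rcases letters_cases j with ⟨-, h1, h2, h3⟩ | ⟨-, h1, h2, h3⟩ <;>
    simp [prevLetter, h1, h2, h3, okTriple]

lemma run_body {f : ℕ → ℕ} (hf : ∀ i, 1 ≤ f i) (j : ℕ) {t : List L2}
    (ht : Run (prevLetter j) (callLetter j) t) :
    ∃ t', body f (j + 1) ++ t = L2.a :: t' ∧ Run .a .a t' := by
  induction j generalizing t with
  | zero =>
    obtain ⟨k, hk⟩ := Nat.exists_eq_add_of_le' (hf 0)
    refine ⟨_, ?_, run_pw_a ht k⟩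
    simp [body, hk, pw_succ, unitPre, callLetter]
  | succ j ih =>
    obtain ⟨k, hk⟩ := Nat.exists_eq_add_of_le' (hf (j + 1))
    rw [body, List.append_assoc]
    apply ih
    rw [hk, pw_succ]
    refine ⟨okTriple_prevLetter j, ?_, run_pw_call j ht k⟩
    rcases letters_cases j with ⟨h0, h1, h2, -⟩ | ⟨h0, h1, h2, -⟩ <;> simp [h0, h1, h2, okTriple]

lemma regexCond_iff_run (w : List L2) : RegexCond w ↔ ∃ t, w = .a :: t ∧ Run .a .a t := by
  constructor
  · intro h
    obtain ⟨m, f, hf, rfl⟩ := RegexCond.exists_blockWord h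
    refine run_body hf m ?_
    obtain ⟨k, hk⟩ := Nat.exists_eq_add_of_le' (hf (m + 1))
    rw [hk, pw_succ]
    refine ⟨okTriple_prevLetter m, ?_⟩
    rcases k with _ | k
    · rcases letters_cases m with ⟨h0, h1, -⟩ | ⟨h0, h1, -⟩ <;> simp [h0, h1, pw, Run, okLast]
    · refine ⟨?_, run_pw_ret m k⟩
      rcases letters_cases m with ⟨h0, h1, -⟩ | ⟨h0, h1, -⟩ <;> simp [h0, h1, okTriple]
  · rintro ⟨t, rfl, ht⟩
    obtain ⟨m, f, hf, hw⟩ := Run.exists_blockWord (u := [.a]) ht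
      ⟨0, fun _ => 1, fun _ => le_rfl, .inl ⟨rfl, rfl, rfl⟩⟩
    rw [List.singleton_append] at hw
    rw [hw]
    exact regexCond_blockWord hf m

lemma run_iff (p c : L2) (t : List L2) : Run p c t ↔
    (∀ i p' c' d, (p :: c :: t)[i]? = some p' → (p :: c :: t)[i + 1]? = some c' →
      (p :: c :: t)[i + 2]? = some d → okTriple p' c' d = true) ∧
    ∃ i p' c', (p :: c :: t)[i]? = some p' ∧ (p :: c :: t)[i + 1]? = some c' ∧
      i + 2 = (p :: c :: t).length ∧ okLast p' c' = true := by
  induction t generalizing p c with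
  | nil =>
    constructor
    · exact fun h => ⟨by simp, 0, p, c, by simp, by simp, by simp, h⟩
    · rintro ⟨-, i, p', c', h1, h2, h3, h4⟩
      obtain rfl : i = 0 := by simpa using h3
      simp only [List.getElem?_cons_zero, List.getElem?_cons_succ, zero_add,
        Option.some.injEq] at h1 h2
      subst h1 h2
      exact h4
  | cons d t ih =>
    rw [Run, ih]
    constructor
    · rintro ⟨h, h1, i, p', c', h2⟩
      refine ⟨?_, i + 1, p', c', by simpa using h2⟩
      rintro (_ | i) p₁ c₁ d₁ e1 e2 e3
      · simp only [List.getElem?_cons_zero, List.getElem?_cons_succ, zero_add,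
          Option.some.injEq] at e1 e2 e3
        subst e1 e2 e3
        exact h
      · exact h1 i p₁ c₁ d₁ (by simpa using e1) (by simpa using e2) (by simpa using e3)
    · rintro ⟨h1, i, p', c', e1, e2, e3, e4⟩
      refine ⟨h1 0 p c d (by simp) (by simp) (by simp), fun i p₁ c₁ d₁ f1 f2 f3 =>
        h1 (i + 1) p₁ c₁ d₁ (by simpa using f1) (by simpa using f2) (by simpa using f3), ?_⟩
      rcases i with _ | i
      · simp at e3
      · exact ⟨i, p', c', by simpa using e1, by simpa using e2, by simpa using e3, e4⟩

lemma regexCond_iff (w : List L2) : RegexCond w ↔ w[0]? = some .a ∧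
    (∀ c, w[1]? = some c → okTriple .a .a c = true) ∧
    (∀ i p c d, w[i]? = some p → w[i + 1]? = some c → w[i + 2]? = some d →
      okTriple p c d = true) ∧
    ∃ i p c, w[i]? = some p ∧ w[i + 1]? = some c ∧ i + 2 = w.length ∧ okLast p c = true := by
  rw [regexCond_iff_run]
  constructor
  · rintro ⟨t, rfl, ht⟩
    obtain ⟨h1, i, p, c, e1, e2, e3, e4⟩ := (run_iff _ _ _).1 ht
    refine ⟨rfl, fun c hc => h1 0 _ _ _ rfl rfl (by simpa using hc), fun i p c d f1 f2 f3 =>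
        h1 (i + 1) p c d (by simpa using f1) (by simpa using f2) (by simpa using f3), ?_⟩
    rcases i with _ | i
    · simp only [List.getElem?_cons_zero, List.getElem?_cons_succ, zero_add,
        Option.some.injEq] at e1 e2
      subst e1 e2
      simp [okLast] at e4
    · exact ⟨i, p, c, by simpa using e1, by simpa using e2, by simpa using e3, e4⟩
  · rintro ⟨h0, h1, h2, i, p, c, e1, e2, e3, e4⟩
    rcases w with _ | ⟨x, t⟩
    · simp at h0
    · obtain rfl : x = .a := by simpa using h0
      refine ⟨t, rfl, (run_iff _ _ _).2 ⟨?_, i + 1, p, c, by simpa using e1, by simpa using e2,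
        by simpa using e3, e4⟩⟩
      rintro (_ | i) p₁ c₁ d₁ f1 f2 f3
      · simp only [List.getElem?_cons_zero, List.getElem?_cons_succ, zero_add,
          Option.some.injEq] at f1 f2
        subst f1 f2
        exact h1 _ (by simpa using f3)
      · exact h2 i p₁ c₁ d₁ (by simpa using f1) (by simpa using f2) (by simpa using f3)

section Formulas

variable {K : ℕ} {A : Type} {h : CRAlphabet K A} {w : List A} {ν : ℕ → ℕ} {V : ℕ → Set ℕ}

def fAnd (φ ψ : MSO A) : MSO A := .not (.or (.not φ) (.not ψ))

def fImp (φ ψ : MSO A) : MSO A := .or (.not φ) ψ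

def fAll (x : ℕ) (φ : MSO A) : MSO A := .not (.ex1 x (.not φ))

def fDisj : List (MSO A) → MSO A
  | [] => .not (.eq 0 0)
  | φ :: l => .or φ (fDisj l)

@[simp] lemma sat_fAnd {φ ψ : MSO A} :
    Sat h w (fAnd φ ψ) ν V ↔ Sat h w φ ν V ∧ Sat h w ψ ν V := by
  simp only [fAnd, Sat]; tauto

@[simp] lemma sat_fImp {φ ψ : MSO A} :
    Sat h w (fImp φ ψ) ν V ↔ (Sat h w φ ν V → Sat h w ψ ν V) := by
  simp only [fImp, Sat]; tauto

@[simp] lemma sat_fAll {x : ℕ} {φ : MSO A} :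
    Sat h w (fAll x φ) ν V ↔ ∀ i < w.length, Sat h w φ (Function.update ν x i) V := by
  simp [fAll, Sat]

@[simp] lemma sat_fDisj {l : List (MSO A)} :
    Sat h w (fDisj l) ν V ↔ ∃ φ ∈ l, Sat h w φ ν V := by
  induction l with
  | nil => simp [fDisj, Sat]
  | cons φ l ih => simp [fDisj, Sat, ih]

@[simp] lemma firstOrder_fAnd {φ ψ : MSO A} :
    FirstOrder (fAnd φ ψ) ↔ FirstOrder φ ∧ FirstOrder ψ := Iff.rfl

@[simp] lemma firstOrder_fImp {φ ψ : MSO A} :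
    FirstOrder (fImp φ ψ) ↔ FirstOrder φ ∧ FirstOrder ψ := Iff.rfl

@[simp] lemma firstOrder_fAll {x : ℕ} {φ : MSO A} :
    FirstOrder (fAll x φ) ↔ FirstOrder φ := Iff.rfl

@[simp] lemma firstOrder_fDisj {l : List (MSO A)} :
    FirstOrder (fDisj l) ↔ ∀ φ ∈ l, FirstOrder φ := by
  induction l with
  | nil => simp [fDisj, FirstOrder]
  | cons φ l ih => simp [fDisj, FirstOrder, ih]

end Formulas

variable {w : List L2} {ν : ℕ → ℕ} {V : ℕ → Set ℕ}

def letters : List L2 := [.a, .abar, .b, .bbar]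

lemma mem_letters (c : L2) : c ∈ letters := by cases c <;> simp [letters]

/-- The positions `x` and `y` carry the same letter. -/
def sameLabel (x y : ℕ) : MSO L2 := fDisj (letters.map fun c => fAnd (.lab c x) (.lab c y))

lemma sat_sameLabel {x y : ℕ} (hx : ν x < w.length) :
    Sat h2 w (sameLabel x y) ν V ↔ w[ν x]? = w[ν y]? := by
  simp only [sameLabel, sat_fDisj, List.mem_map, exists_exists_and_eq_and, sat_fAnd, Sat]
  constructor
  · rintro ⟨c, -, h1, h2⟩
    rw [h1, h2]
  · intro h
    obtain ⟨c, hc⟩ : ∃ c, w[ν x]? = some c := ⟨_, List.getElem?_eq_getElem hx⟩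
    exact ⟨c, mem_letters c, hc, h ▸ hc⟩

/-- The position `y` is one or two steps after `x`. -/
def near (x y : ℕ) : MSO L2 :=
  .or (.succ x y) (.ex1 9 (fAnd (.succ x 9) (.succ 9 y)))

lemma sat_near {x y : ℕ} (hx : x ≠ 9) (hy : y ≠ 9) (hyl : ν y < w.length) :
    Sat h2 w (near x y) ν V ↔ (ν y = ν x + 1 ∨ ν y = ν x + 2) := by
  simp only [near, Sat, sat_fAnd, Function.update_self, Function.update_of_ne hx,
    Function.update_of_ne hy]
  constructor
  · rintro (h | ⟨i, -, h⟩) <;> omega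
  · rintro (h | h)
    · exact .inl ⟨h, hyl⟩
    · exact .inr ⟨ν x + 1, by omega, by omega⟩

def isFirst (x : ℕ) : MSO L2 := .not (.ex1 9 (.succ 9 x))

lemma sat_isFirst {x : ℕ} (hx : x ≠ 9) (hxl : ν x < w.length) :
    Sat h2 w (isFirst x) ν V ↔ ν x = 0 := by
  simp only [isFirst, Sat, Function.update_self, Function.update_of_ne hx]
  constructor
  · intro h
    by_contra h0
    exact h ⟨ν x - 1, by omega, by omega⟩
  · rintro h ⟨i, -, h'⟩
    omega

def isLast (x : ℕ) : MSO L2 := .not (.ex1 9 (.succ x 9))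

lemma sat_isLast {x : ℕ} (hx : x ≠ 9) (hxl : ν x < w.length) :
    Sat h2 w (isLast x) ν V ↔ ν x + 1 = w.length := by
  simp only [isLast, Sat, Function.update_self, Function.update_of_ne hx]
  constructor
  · intro h
    by_contra h0
    exact h ⟨ν x + 1, by omega, by omega⟩
  · rintro h ⟨i, -, h'⟩
    omega

def labelTriple (x y z : ℕ) : MSO L2 :=
  fDisj (letters.flatMap fun p => letters.flatMap fun c =>
    (letters.filter fun d => okTriple p c d).map fun d =>
      fAnd (.lab p x) (fAnd (.lab c y) (.lab d z)))

lemma sat_labelTriple {x y z : ℕ} : Sat h2 w (labelTriple x y z) ν V ↔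
    ∃ p c d, okTriple p c d = true ∧ w[ν x]? = some p ∧ w[ν y]? = some c ∧
      w[ν z]? = some d := by
  simp only [labelTriple, sat_fDisj, List.mem_flatMap, List.mem_map, List.mem_filter]
  constructor
  · rintro ⟨_, ⟨p, -, c, -, d, ⟨-, h⟩, rfl⟩, h'⟩
    exact ⟨p, c, d, h, by simpa [Sat] using h'⟩
  · rintro ⟨p, c, d, h, h'⟩
    exact ⟨_, ⟨p, mem_letters p, c, mem_letters c, d, ⟨mem_letters d, h⟩, rfl⟩,
      by simpa [Sat] using h'⟩

def labelSecond (x : ℕ) : MSO L2 :=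
  fDisj ((letters.filter fun d => okTriple .a .a d).map fun d => .lab d x)

lemma sat_labelSecond {x : ℕ} : Sat h2 w (labelSecond x) ν V ↔
    ∃ d, okTriple .a .a d = true ∧ w[ν x]? = some d := by
  simp only [labelSecond, sat_fDisj, List.mem_map, List.mem_filter]
  constructor
  · rintro ⟨_, ⟨d, ⟨-, h⟩, rfl⟩, h'⟩
    exact ⟨d, h, h'⟩
  · rintro ⟨d, h, h'⟩
    exact ⟨_, ⟨d, ⟨mem_letters d, h⟩, rfl⟩, h'⟩

def labelLast (x y : ℕ) : MSO L2 :=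
  fDisj (letters.flatMap fun p => (letters.filter fun c => okLast p c).map fun c =>
    fAnd (.lab p x) (.lab c y))

lemma sat_labelLast {x y : ℕ} : Sat h2 w (labelLast x y) ν V ↔
    ∃ p c, okLast p c = true ∧ w[ν x]? = some p ∧ w[ν y]? = some c := by
  simp only [labelLast, sat_fDisj, List.mem_flatMap, List.mem_map, List.mem_filter]
  constructor
  · rintro ⟨_, ⟨p, -, c, ⟨-, h⟩, rfl⟩, h'⟩
    exact ⟨p, c, h, by simpa [Sat] using h'⟩
  · rintro ⟨p, c, h, h'⟩
    exact ⟨_, ⟨p, mem_letters p, c, ⟨mem_letters c, h⟩, rfl⟩, by simpa [Sat] using h'⟩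

def regexFormula : MSO L2 :=
  fAnd (.ex1 0 (fAnd (isFirst 0) (.lab .a 0))) <|
  fAnd (fAll 0 (fAll 1 (fImp (isFirst 0) (fImp (.succ 0 1) (labelSecond 1))))) <|
  fAnd (fAll 0 (fAll 1 (fAll 2
    (fImp (.succ 0 1) (fImp (.succ 1 2) (labelTriple 0 1 2)))))) <|
  .ex1 0 (.ex1 1 (fAnd (.succ 0 1) (fAnd (isLast 1) (labelLast 0 1))))

lemma lt_of_getElem?_eq_some {i : ℕ} {c : L2} (h : w[i]? = some c) : i < w.length :=
  (List.getElem?_eq_some_iff.1 h).1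

lemma sat_regexFormula : Sat h2 w regexFormula ν V ↔ RegexCond w := by
  rw [regexCond_iff, regexFormula]
  simp only [sat_fAnd]
  refine and_congr ?_ (and_congr ?_ (and_congr ?_ ?_))
  · simp only [Sat, sat_fAnd]
    constructor
    · rintro ⟨i, hi, h1, h2⟩
      rw [sat_isFirst (by simp) (by simpa using hi)] at h1
      simp only [Function.update_self] at h1 h2
      rwa [h1] at h2
    · intro h
      have h0 := lt_of_getElem?_eq_some h
      refine ⟨0, h0, ?_, by simpa using h⟩
      rw [sat_isFirst (by simp) (by simpa using h0)]
      simp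
  · simp only [sat_fAll, sat_fImp, sat_labelSecond]
    constructor
    · intro h c hc
      have h1 := lt_of_getElem?_eq_some hc
      obtain ⟨d, hd, hd'⟩ := h 0 (by omega) 1 h1
        ((sat_isFirst (by simp) (by simp; omega)).2 (by simp)) ⟨by simp, by simpa using h1⟩
      simp only [Function.update_self, hc, Option.some.injEq] at hd'
      exact hd' ▸ hd
    · intro h i hi j hj hf hs
      rw [sat_isFirst (by simp) (by simpa using hi)] at hf
      simp [Sat] at hf hs
      obtain rfl : j = 1 := by omega
      exact ⟨_, h _ (List.getElem?_eq_getElem hj), by simp [hj]⟩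
  · simp only [sat_fAll, sat_fImp, sat_labelTriple]
    constructor
    · intro h i p c d hp hc hd
      have h1 := lt_of_getElem?_eq_some hd
      obtain ⟨p', c', d', hok, e1, e2, e3⟩ := h i (by omega) (i + 1) (by omega) (i + 2) h1
        (by simp [Sat]; omega) (by simp [Sat]; omega)
      simp [hp, hc, hd] at e1 e2 e3
      subst e1 e2 e3
      exact hok
    · intro h i hi j hj k hk h1 h2
      simp [Sat] at h1 h2
      obtain rfl : j = i + 1 := by omega
      obtain rfl : k = i + 2 := by omega
      exact ⟨_, _, _, h i _ _ _ (List.getElem?_eq_getElem hi) (List.getElem?_eq_getElem hj)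
        (List.getElem?_eq_getElem hk), by simp [hi], by simp [hj], by simp [hk]⟩
  · simp only [Sat, sat_fAnd, sat_labelLast]
    constructor
    · rintro ⟨i, hi, j, hj, ⟨hs, -⟩, hl, p, c, hok, hp, hc⟩
      rw [sat_isLast (by simp) (by simpa using hj)] at hl
      simp at hs hl hp hc
      subst hs
      exact ⟨i, p, c, hp, hc, by omega, hok⟩
    · rintro ⟨i, p, c, hp, hc, hl, hok⟩
      refine ⟨i, by omega, i + 1, by omega, ⟨by simp, by simp; omega⟩, ?_, p, c, hok,
        by simpa using hp, by simpa using hc⟩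
      rw [sat_isLast (by simp) (by simp; omega)]
      simpa using hl

def matchedFormula : MSO L2 := fAll 0 (.ex1 1 (.or (.mu 0 1) (.mu 1 0)))

lemma sat_matchedFormula : Sat h2 w matchedFormula ν V ↔ AllMatched w := by
  simp only [matchedFormula, sat_fAll, Sat, AllMatched]
  refine forall₂_congr fun i hi => ?_
  constructor
  · rintro ⟨j, -, h⟩
    exact ⟨j, by simpa using h⟩
  · rintro ⟨j, h⟩
    refine ⟨j, ?_, by simpa using h⟩
    rcases h with h | h
    · exact (lt_of_muAny h).2
    · exact (lt_of_muAny h).1.trans hi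

/-- The positions `x` and `y` are two steps apart and the position between them does not
carry the letter of `x`. -/
def skips (x y : ℕ) : MSO L2 :=
  .ex1 9 (fAnd (.succ x 9) (fAnd (.succ 9 y) (.not (sameLabel 9 x))))

lemma sat_skips {x y : ℕ} (hx : x ≠ 9) (hy : y ≠ 9) (hyl : ν y < w.length) :
    Sat h2 w (skips x y) ν V ↔ (ν y = ν x + 2 ∧ w[ν x + 1]? ≠ w[ν x]?) := by
  simp only [skips, Sat, sat_fAnd]
  constructor
  · rintro ⟨i, hi, h1, h2, h3⟩
    rw [sat_sameLabel (by simpa using hi)] at h3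
    simp only [Function.update_self, Function.update_of_ne hx, Function.update_of_ne hy]
      at h1 h2 h3
    obtain rfl := h1.1
    exact ⟨h2.1, h3⟩
  · rintro ⟨h1, h2⟩
    refine ⟨ν x + 1, by omega, ?_, ?_, ?_⟩
    · simp only [Function.update_self, Function.update_of_ne hx, true_and]; omega
    · simp only [Function.update_self, Function.update_of_ne hy]; omega
    · have hlt : Function.update ν 9 (ν x + 1) 9 < w.length := by
        simp only [Function.update_self]; omega
      rw [sat_sameLabel hlt]
      simpa only [Function.update_self, Function.update_of_ne hx] using h2

def twoApart (x y : ℕ) : MSO L2 := .ex1 9 (fAnd (.succ x 9) (.succ 9 y))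

lemma sat_twoApart {x y : ℕ} (hx : x ≠ 9) (hy : y ≠ 9) (hyl : ν y < w.length) :
    Sat h2 w (twoApart x y) ν V ↔ ν y = ν x + 2 := by
  simp only [twoApart, Sat, sat_fAnd, Function.update_self, Function.update_of_ne hx,
    Function.update_of_ne hy]
  constructor
  · rintro ⟨i, -, h⟩
    omega
  · exact fun h => ⟨ν x + 1, by omega, by omega⟩

/-- The consistency condition on the matched pairs `(0, 1)` and `(2, 3)`. -/
def consistentMatrix : MSO L2 :=
  fImp (.mu 0 1) <| fImp (.mu 2 3) <| fImp (sameLabel 0 2) <|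
  fAnd (fImp (.lab .a 0) (fImp (.succ 0 2) (near 3 1))) <|
  fAnd (fImp (.lab .abar 1) (fImp (.succ 3 1) (near 0 2))) <|
  fAnd (fImp (.lab .bbar 1) (fImp (.succ 3 1) (twoApart 0 2))) <|
  fAnd (fImp (skips 0 2) (near 3 1)) (fImp (skips 3 1) (near 0 2))

def consistentFormula : MSO L2 := fAll 0 (fAll 1 (fAll 2 (fAll 3 consistentMatrix)))

lemma sat_consistentMatrix (h0 : ν 0 < w.length) (h1 : ν 1 < w.length) (h2' : ν 2 < w.length) :
    Sat h2 w consistentMatrix ν V ↔ (MuAny h2 w (ν 0) (ν 1) → MuAny h2 w (ν 2) (ν 3) →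
    w[ν 0]? = w[ν 2]? →
    ((w[ν 0]? = some L2.a → ν 2 = ν 0 + 1 → (ν 1 = ν 3 + 1 ∨ ν 1 = ν 3 + 2)) ∧
     (w[ν 1]? = some L2.abar → ν 1 = ν 3 + 1 → (ν 2 = ν 0 + 1 ∨ ν 2 = ν 0 + 2)) ∧
     (w[ν 1]? = some L2.bbar → ν 1 = ν 3 + 1 → ν 2 = ν 0 + 2) ∧
     (ν 2 = ν 0 + 2 → w[ν 0 + 1]? ≠ w[ν 0]? → (ν 1 = ν 3 + 1 ∨ ν 1 = ν 3 + 2)) ∧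
     (ν 1 = ν 3 + 2 → w[ν 3 + 1]? ≠ w[ν 3]? → (ν 2 = ν 0 + 1 ∨ ν 2 = ν 0 + 2)))) := by
  simp only [consistentMatrix, sat_fImp, sat_fAnd, sat_sameLabel h0,
    sat_near (show 3 ≠ 9 by decide) (show 1 ≠ 9 by decide) h1,
    sat_near (show 0 ≠ 9 by decide) (show 2 ≠ 9 by decide) h2',
    sat_twoApart (show 0 ≠ 9 by decide) (show 2 ≠ 9 by decide) h2',
    sat_skips (show 3 ≠ 9 by decide) (show 1 ≠ 9 by decide) h1,
    sat_skips (show 0 ≠ 9 by decide) (show 2 ≠ 9 by decide) h2', and_imp]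
  simp only [Sat, h1, h2', and_true]

lemma sat_consistentFormula : Sat h2 w consistentFormula ν V ↔ Consistent w := by
  simp only [consistentFormula, sat_fAll]
  constructor
  · intro h x₁ y₁ x₂ y₂ m₁ m₂
    obtain ⟨l₁, l₂⟩ := lt_of_muAny m₁
    obtain ⟨l₃, l₄⟩ := lt_of_muAny m₂
    have := h x₁ (l₁.trans l₂) y₁ l₂ x₂ (l₃.trans l₄) y₂ l₄
    rw [sat_consistentMatrix (by simp; omega) (by simp; omega) (by simp; omega)] at this
    exact this m₁ m₂
  · intro h x₁ hx₁ y₁ hy₁ x₂ hx₂ y₂ hy₂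
    rw [sat_consistentMatrix (by simpa using hx₁) (by simpa using hy₁) (by simpa using hx₂)]
    exact h x₁ y₁ x₂ y₂

def gridFormula : MSO L2 := fAnd regexFormula (fAnd matchedFormula consistentFormula)

lemma sat_gridFormula :
    Sat h2 w gridFormula ν V ↔ RegexCond w ∧ AllMatched w ∧ Consistent w := by
  rw [gridFormula, sat_fAnd, sat_fAnd, sat_regexFormula, sat_matchedFormula,
    sat_consistentFormula]

lemma firstOrder_gridFormula : FirstOrder gridFormula := by
  simp [gridFormula, regexFormula, matchedFormula, consistentFormula, consistentMatrix, skips,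
    twoApart, near, sameLabel, labelLast, labelSecond, labelTriple, isFirst, isLast, letters,
    FirstOrder, okTriple, okLast]

end GridEncoding

/-- the image `Φ(𝔾)` of the set of all grids under the grid
encoding equals the set of nested words satisfying (i), (ii) and (iii); in
particular, `Φ(𝔾)` is `Σ₁(τ_Σ̃)`-definable relative to all nested words. -/
theorem stmt17 :
    ({w : List L2 | ∃ n m, 1 ≤ n ∧ 1 ≤ m ∧ w = encodeGrid n m} =
      {w : List L2 | RegexCond w ∧ AllMatched w ∧ Consistent w}) ∧
    ∃ φ : MSO L2, IsEMSO φ ∧ ClosedOn h2 φ ∧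
      mLang h2 φ = {w : List L2 | ∃ n m, 1 ≤ n ∧ 1 ≤ m ∧ w = encodeGrid n m} := by
  refine ⟨Set.ext fun w => GridEncoding.exists_encodeGrid_iff w, GridEncoding.gridFormula,
    .fo GridEncoding.firstOrder_gridFormula,
    fun w ν ν' V V' => GridEncoding.sat_gridFormula.trans GridEncoding.sat_gridFormula.symm,
    Set.ext fun w => ?_⟩
  refine (and_congr_right fun _ => GridEncoding.sat_gridFormula).trans ?_
  rw [← GridEncoding.exists_encodeGrid_iff]
  refine and_iff_right_of_imp ?_
  rintro h rfl
  obtain ⟨h0, -⟩ :=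
    (GridEncoding.regexCond_iff _).1 ((GridEncoding.exists_encodeGrid_iff _).1 h).1
  simp at h0
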